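/- Let f : ℝ × ℝ^N → ℝ^N be Lipschitz Carathéodory with L¹_loc-equicontinuous m-bounds, and let Θ = {θ_j^I} be the suitable set of moduli of continuity defined by θ_j^I(s) := sup_{t ∈ ℝ} ∫_t^{t+s} m^j(u) du, where m^j(t) = sup_{|x|≤j} |f(t,x)| is the optimal m-bound of f on B_j. Let g be Lipschitz Carathéodory such that the translates f_{t_n} converge to g in the σ_Θ sense for some sequence t_n → +∞. Assume that for every s ≥ 0 and every x₀ ∈ ℝ^N the solution x(·, f_s, x₀) of ẋ = f_s(t,x), x(0) = x₀ is defined on [0,∞), and that for every r ∈ ℝ and x₀ ∈ ℝ^N the solution x(·, g_r, x₀) is defined on [0,∞). Suppose there exist τ ∈ ℝ and c > 0 such that for every d > 0 there is T(d) > 0 with |x(t, f_r, x₀)| ≤ c whenever r ≥ τ, t ≥ T(d) and |x₀| ≤ d (the solutions of ẋ = f(t,x) are uniformly ultimately bounded on [τ,∞)). Then the solutions of ẋ = g(t,x) are uniformly ultimately bounded: for every d > 0 there is T'(d) > 0 such that |x(t, g_r, x₀)| ≤ c for every r ∈ ℝ, every t ≥ T'(d), and every x₀ with |x₀| ≤ d.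 -/

import Mathlib

open MeasureTheory Set Filter Topology
open scoped RealInnerProductSpace

noncomputable section

abbrev Euc (n : ℕ) := EuclideanSpace ℝ (Fin n)

/-- A function `ℝ → ℝ` is locally integrable (w.r.t. Lebesgue measure) on every
compact interval. -/
def LocInt (m : ℝ → ℝ) : Prop := ∀ a b : ℝ, IntegrableOn m (Icc a b)

section Defs

variable {N : ℕ} {F : Type*} [NormedAddCommGroup F] [NormedSpace ℝ F]

/-- The Carathéodory conditions (C1) and (C2). -/
def IsCara (f : ℝ → Euc N → F) : Prop :=
  StronglyMeasurable (Function.uncurry f) ∧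
  ∀ K : Set (Euc N), IsCompact K → ∃ m : ℝ → ℝ, (∀ t, 0 ≤ m t) ∧ LocInt m ∧
    ∀ᵐ t : ℝ, ∀ x ∈ K, ‖f t x‖ ≤ m t

/-- A suitable set of moduli of continuity `Θ = {θ_j^{[q₁,q₂]}}`. -/
structure SuitableModuli where
  θ : ℕ → ℚ → ℚ → ℝ → ℝ
  nonneg : ∀ j q₁ q₂ s, (0:ℝ) ≤ s → 0 ≤ θ j q₁ q₂ s
  cont : ∀ j q₁ q₂, ContinuousOn (θ j q₁ q₂) (Ici 0)
  mono : ∀ j q₁ q₂, MonotoneOn (θ j q₁ q₂) (Ici 0)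
  zero : ∀ j q₁ q₂, θ j q₁ q₂ 0 = 0
  ordered : ∀ j₁ j₂ q₁ q₂ p₁ p₂, j₁ ≤ j₂ → p₁ ≤ q₁ → q₂ ≤ p₂ →
    ∀ s : ℝ, 0 ≤ s → θ j₁ q₁ q₂ s ≤ θ j₂ p₁ p₂ s

/-- `x ∈ K_j^{[q₁,q₂]}`: continuous, bounded by `j` and with modulus of continuity
`θ_j^{[q₁,q₂]}` on `[q₁,q₂]`. -/
def inK {N : ℕ} (Θ : SuitableModuli) (j : ℕ) (q₁ q₂ : ℚ) (x : ℝ → Euc N) : Prop :=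
  ContinuousOn x (Icc (q₁:ℝ) (q₂:ℝ)) ∧
  (∀ t ∈ Icc (q₁:ℝ) (q₂:ℝ), ‖x t‖ ≤ (j:ℝ)) ∧
  ∀ t ∈ Icc (q₁:ℝ) (q₂:ℝ), ∀ s ∈ Icc (q₁:ℝ) (q₂:ℝ), ‖x t - x s‖ ≤ Θ.θ j q₁ q₂ |t - s|

/-- Weak Θ-Carathéodory functions: Carathéodory conditions plus condition (W). -/
def IsWTC (Θ : SuitableModuli) (f : ℝ → Euc N → F) : Prop :=
  IsCara f ∧
  ∀ (j : ℕ) (q₁ q₂ : ℚ) (xs : ℕ → ℝ → Euc N) (x : ℝ → Euc N),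
    (∀ n, inK Θ j q₁ q₂ (xs n)) → inK Θ j q₁ q₂ x →
    TendstoUniformlyOn (fun n t => xs n t) x atTop (Icc (q₁:ℝ) (q₂:ℝ)) →
    Tendsto (fun n => ∫ t in Icc (q₁:ℝ) (q₂:ℝ), f t (xs n t)) atTop
      (𝓝 (∫ t in Icc (q₁:ℝ) (q₂:ℝ), f t (x t)))

/-- Convergence in the `σ_Θ` sense:
`sup_{x ∈ K_j^I} ‖∫_I (f_n(t,x(t)) − f(t,x(t))) dt‖ → 0` for every `j` and `I`. -/
def SigmaTendsto (Θ : SuitableModuli) (fs : ℕ → ℝ → Euc N → F) (f : ℝ → Euc N → F) : Prop :=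
  ∀ (j : ℕ) (q₁ q₂ : ℚ), ∀ ε > (0:ℝ), ∀ᶠ n in atTop, ∀ x : ℝ → Euc N, inK Θ j q₁ q₂ x →
    ‖∫ t in Icc (q₁:ℝ) (q₂:ℝ), (fs n t (x t) - f t (x t))‖ < ε

end Defs

/-- Lipschitz Carathéodory functions. -/
def IsLC {N : ℕ} (f : ℝ → Euc N → Euc N) : Prop :=
  IsCara f ∧
  ∀ K : Set (Euc N), IsCompact K → ∃ l : ℝ → ℝ, LocInt l ∧
    ∀ᵐ t : ℝ, ∀ x ∈ K, ∀ y ∈ K, ‖f t x - f t y‖ ≤ l t * ‖x - y‖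

/-- The optimal m-bound of `f` on the closed ball `B_j`. -/
def mOpt {N : ℕ} (f : ℝ → Euc N → Euc N) (j : ℕ) (t : ℝ) : ℝ :=
  sSup {v : ℝ | ∃ x : Euc N, ‖x‖ ≤ (j:ℝ) ∧ v = ‖f t x‖}

/-- The time translation `f_r(s,x) = f(s+r,x)`. -/
def timeTranslate {N : ℕ} (f : ℝ → Euc N → Euc N) (r : ℝ) : ℝ → Euc N → Euc N :=
  fun s x => f (s + r) x

/-- `x` is a solution of `ẋ = g(t,x)`, `x(0) = x₀`, defined on `[0,∞)`. -/
def IsSolOn {N : ℕ} (g : ℝ → Euc N → Euc N) (x₀ : Euc N) (x : ℝ → Euc N) : Prop :=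
  ContinuousOn x (Ici 0) ∧ ∀ t ∈ Ici (0:ℝ), x t = x₀ + ∫ s in (0:ℝ)..t, g s (x s)

/-! ### Local integrability -/

theorem LocInt.intervalIntegrable {m : ℝ → ℝ} (hm : LocInt m) (a b : ℝ) :
    IntervalIntegrable m volume a b :=
  ((intervalIntegrable_iff_integrableOn_Icc_of_le (min_le_max (a := a) (b := b))).2 (hm _ _)).mono_set
    (by rw [uIcc_of_le min_le_max, uIcc])

theorem LocInt.comp_add_right {m : ℝ → ℝ} (hm : LocInt m) (r : ℝ) :
    LocInt fun t => m (t + r) := by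
  intro a b
  rcases le_total a b with hab | hab
  · rw [← intervalIntegrable_iff_integrableOn_Icc_of_le hab]
    simpa using (hm.intervalIntegrable (a + r) (b + r)).comp_add_right r
  · have : volume.restrict (Icc a b) = 0 := by simp [hab]
    rw [IntegrableOn, this]
    exact integrable_zero_measure

theorem LocInt.abs {m : ℝ → ℝ} (hm : LocInt m) : LocInt fun t => |m t| :=
  fun a b => (hm a b).abs

/-- The primitive of a locally integrable function is uniformly continuous on compact
intervals. -/
theorem LocInt.exists_integral_lt {m : ℝ → ℝ} (hm : LocInt m) (A B : ℝ) {ε : ℝ} (hε : 0 < ε) :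
    ∃ δ > 0, ∀ a b, A ≤ a → a ≤ b → b ≤ B → b - a < δ → ∫ t in a..b, m t < ε := by
  have hcont := intervalIntegral.continuous_primitive hm.intervalIntegrable 0
  obtain ⟨δ, hδ, h⟩ := Metric.uniformContinuousOn_iff.1
    ((isCompact_Icc (a := A) (b := B)).uniformContinuousOn_of_continuous hcont.continuousOn) ε hε
  refine ⟨δ, hδ, fun a b ha hab hb hd => ?_⟩
  have h1 := h b ⟨ha.trans hab, hb⟩ a ⟨ha, hab.trans hb⟩
    (by rwa [Real.dist_eq, abs_of_nonneg (sub_nonneg.2 hab)])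
  rw [Real.dist_eq, intervalIntegral.integral_interval_sub_left
    (hm.intervalIntegrable _ _) (hm.intervalIntegrable _ _)] at h1
  exact (le_abs_self _).trans_lt h1

/-- A Grönwall inequality with a locally integrable weight; the constant depends only on the
weight and on the ambient interval. -/
theorem exists_gronwall_const {l : ℝ → ℝ} (hl : LocInt l) (hl0 : ∀ t, 0 ≤ l t) (A B : ℝ) :
    ∃ C : ℝ, 0 ≤ C ∧ ∀ ε : ℝ, 0 ≤ ε → ∀ S ≤ B, ∀ u : ℝ → ℝ, ContinuousOn u (Icc A S) →
      (∀ t, 0 ≤ u t) → (∀ t ∈ Icc A S, u t ≤ ε + ∫ s in A..t, l s * u s) →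
      ∀ t ∈ Icc A S, u t ≤ C * ε := by
  obtain ⟨δ, hδ, hsmall⟩ := hl.exists_integral_lt A B (half_pos one_pos)
  have key : ∀ k : ℕ, ∃ C : ℝ, 0 ≤ C ∧ ∀ ε : ℝ, 0 ≤ ε → ∀ S ≤ B, ∀ u : ℝ → ℝ,
      ContinuousOn u (Icc A S) → (∀ t, 0 ≤ u t) →
      (∀ t ∈ Icc A S, u t ≤ ε + ∫ s in A..t, l s * u s) →
      ∀ t ∈ Icc A S, t ≤ A + k * (δ / 2) → u t ≤ C * ε := by
    intro k
    induction k with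
    | zero =>
      refine ⟨1, zero_le_one, fun ε _ S _ u _ _ hu t ht htk => ?_⟩
      obtain rfl : t = A := le_antisymm (by simpa using htk) ht.1
      simpa using hu t ht
    | succ k ih =>
      obtain ⟨C, hC, ih⟩ := ih
      set L := |∫ s in A..B, l s|
      refine ⟨max C (2 * (1 + C * L)), le_max_of_le_left hC, ?_⟩
      intro ε hε S hS u hcont hu0 hu t ht htk
      by_cases htp : t ≤ A + k * (δ / 2)
      · exact (ih ε hε S hS u hcont hu0 hu t ht htp).trans
          (mul_le_mul_of_nonneg_right (le_max_left _ _) hε)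
      push Not at htp
      set p := A + k * (δ / 2)
      have hAp : A ≤ p := le_add_of_nonneg_right (by positivity)
      have hsub : Icc p t ⊆ Icc A S := Icc_subset_Icc hAp ht.2
      obtain ⟨t₁, ht₁, hmax⟩ := (isCompact_Icc (a := p) (b := t)).exists_isMaxOn
        ⟨t, right_mem_Icc.2 htp.le⟩ (hcont.mono hsub)
      have hint : ∀ a b, a ∈ Icc A S → b ∈ Icc A S → a ≤ b →
          IntervalIntegrable (fun s => l s * u s) volume a b := by
        intro a b ha hb hab
        refine (hl.intervalIntegrable a b).mul_continuousOn (hcont.mono ?_)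
        rw [uIcc_of_le hab]
        exact Icc_subset_Icc ha.1 hb.2
      have hpS : p ∈ Icc A S := ⟨hAp, htp.le.trans ht.2⟩
      have hAS : A ∈ Icc A S := left_mem_Icc.2 (ht.1.trans ht.2)
      have h1 : ∫ s in A..p, l s * u s ≤ C * ε * L := by
        calc ∫ s in A..p, l s * u s ≤ ∫ s in A..p, l s * (C * ε) := by
              refine intervalIntegral.integral_mono_on hAp (hint _ _ hAS hpS hAp)
                ((hl.intervalIntegrable _ _).mul_const _) fun s hs => ?_
              exact mul_le_mul_of_nonneg_left
                (ih ε hε S hS u hcont hu0 hu s ⟨hs.1, hs.2.trans hpS.2⟩ hs.2) (hl0 s)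
          _ = C * ε * ∫ s in A..p, l s := by
              rw [intervalIntegral.integral_mul_const, mul_comm]
          _ ≤ C * ε * L := by
              refine mul_le_mul_of_nonneg_left (le_trans ?_ (le_abs_self _)) (by positivity)
              exact intervalIntegral.integral_mono_interval le_rfl hAp (hpS.2.trans hS)
                (Eventually.of_forall hl0) (hl.intervalIntegrable _ _)
      have h2 : ∫ s in p..t₁, l s * u s ≤ u t₁ * (1 / 2) := by
        calc ∫ s in p..t₁, l s * u s ≤ ∫ s in p..t₁, l s * u t₁ := by
              refine intervalIntegral.integral_mono_on ht₁.1 (hint _ _ hpS (hsub ht₁) ht₁.1)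
                ((hl.intervalIntegrable _ _).mul_const _) fun s hs => ?_
              exact mul_le_mul_of_nonneg_left (hmax ⟨hs.1, hs.2.trans ht₁.2⟩) (hl0 s)
          _ = u t₁ * ∫ s in p..t₁, l s := by
              rw [intervalIntegral.integral_mul_const, mul_comm]
          _ ≤ u t₁ * (1 / 2) := by
              refine mul_le_mul_of_nonneg_left (hsmall p t₁ hAp ht₁.1
                ((hsub ht₁).2.trans hS) ?_).le (hu0 _)
              have : p + δ / 2 = A + ((k + 1 : ℕ) : ℝ) * (δ / 2) := by
                simp only [p]; push_cast; ring
              linarith [ht₁.2]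
      have h3 := hu t₁ (hsub ht₁)
      rw [← intervalIntegral.integral_add_adjacent_intervals (hint _ _ hAS hpS hAp)
        (hint _ _ hpS (hsub ht₁) ht₁.1)] at h3
      have h4 : u t ≤ u t₁ := hmax (right_mem_Icc.2 htp.le)
      calc u t ≤ 2 * (1 + C * L) * ε := by linarith
        _ ≤ _ := mul_le_mul_of_nonneg_right (le_max_right _ _) hε
  obtain ⟨k, hk⟩ := exists_nat_ge ((B - A) / (δ / 2))
  obtain ⟨C, hC, h⟩ := key k
  refine ⟨C, hC, fun ε hε S hS u hcont hu0 hu t ht => h ε hε S hS u hcont hu0 hu t ht ?_⟩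
  rw [div_le_iff₀ (by positivity)] at hk
  linarith [ht.2]

/-! ### Optimal m-bounds -/

section

variable {N : ℕ} {f g : ℝ → Euc N → Euc N}

theorem mOpt_nonneg (f : ℝ → Euc N → Euc N) (j : ℕ) (t : ℝ) : 0 ≤ mOpt f j t :=
  Real.sSup_nonneg (by rintro _ ⟨x, -, rfl⟩; exact norm_nonneg _)

theorem IsCara.exists_bound (hf : IsCara f) (j : ℕ) :
    ∃ m : ℝ → ℝ, (∀ t, 0 ≤ m t) ∧ LocInt m ∧
      ∀ᵐ t : ℝ, ∀ x : Euc N, ‖x‖ ≤ j → ‖f t x‖ ≤ m t := by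
  obtain ⟨m, hm0, hm, h⟩ := hf.2 _ (isCompact_closedBall (0 : Euc N) (j : ℝ))
  exact ⟨m, hm0, hm, by simpa using h⟩

theorem IsLC.exists_lipschitz (hf : IsLC f) (j : ℕ) :
    ∃ l : ℝ → ℝ, (∀ t, 0 ≤ l t) ∧ LocInt l ∧
      ∀ᵐ t : ℝ, ∀ x y : Euc N, ‖x‖ ≤ j → ‖y‖ ≤ j → ‖f t x - f t y‖ ≤ l t * ‖x - y‖ := by
  obtain ⟨l, hl, h⟩ := hf.2 _ (isCompact_closedBall (0 : Euc N) (j : ℝ))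
  refine ⟨fun t => |l t|, fun t => abs_nonneg _, hl.abs, h.mono fun t ht x y hx hy => ?_⟩
  exact (ht x (by simpa using hx) y (by simpa using hy)).trans
    (mul_le_mul_of_nonneg_right (le_abs_self _) (norm_nonneg _))

theorem IsCara.norm_le_mOpt (hf : IsCara f) (j : ℕ) :
    ∀ᵐ t : ℝ, ∀ x : Euc N, ‖x‖ ≤ j → ‖f t x‖ ≤ mOpt f j t := by
  obtain ⟨m, -, -, h⟩ := hf.exists_bound j
  filter_upwards [h] with t ht x hx
  exact le_csSup ⟨m t, by rintro _ ⟨y, hy, rfl⟩; exact ht y hy⟩ ⟨x, hx, rfl⟩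

theorem IsLC.locInt_mOpt (hf : IsLC f) (j : ℕ) : LocInt (mOpt f j) := by
  obtain ⟨m, hm0, hm, hfm⟩ := hf.1.exists_bound j
  obtain ⟨l, hl0, -, hfl⟩ := hf.exists_lipschitz j
  let K := Metric.closedBall (0 : Euc N) (j : ℝ)
  have hK : Nonempty K := ⟨0, by simp [K]⟩
  let d := TopologicalSpace.denseSeq K
  have hd : DenseRange d := TopologicalSpace.denseRange_denseSeq K
  have hdn : ∀ x : K, ‖(x : Euc N)‖ ≤ j := fun x => mem_closedBall_zero_iff.1 x.2
  have hmeas : Measurable fun t => ⨆ n, ‖f t (d n)‖ := by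
    refine Measurable.iSup fun n => ?_
    exact (hf.1.1.measurable.comp (measurable_id.prodMk measurable_const)).norm
  have heq : (fun t => ⨆ n, ‖f t (d n)‖) =ᵐ[volume] mOpt f j := by
    filter_upwards [hf.1.norm_le_mOpt j, hfl] with t ht hlip
    have hbdd : BddAbove (range fun n => ‖f t (d n)‖) :=
      ⟨mOpt f j t, by rintro _ ⟨n, rfl⟩; exact ht _ (hdn _)⟩
    refine le_antisymm (ciSup_le fun n => ht _ (hdn _))
      (csSup_le ⟨_, 0, by simp, rfl⟩ ?_)
    rintro _ ⟨x, hx, rfl⟩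
    have hcont : Continuous fun y : K => f t y :=
      (LipschitzWith.of_dist_le_mul (K := (l t).toNNReal) fun y z => by
        rw [Subtype.dist_eq, dist_eq_norm, dist_eq_norm, Real.coe_toNNReal _ (hl0 t)]
        exact hlip _ _ (hdn y) (hdn z)).continuous
    exact hd.induction_on (p := fun y : K => ‖f t y‖ ≤ ⨆ n, ‖f t (d n)‖)
      (⟨x, by simpa [K] using hx⟩ : K)
      (isClosed_le hcont.norm continuous_const) fun n => le_ciSup hbdd n
  intro a b
  refine (hm a b).mono' (hmeas.aestronglyMeasurable.congr heq).restrict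
    (ae_restrict_of_ae (hfm.mono fun t ht => ?_))
  rw [Real.norm_of_nonneg (mOpt_nonneg f j t)]
  exact csSup_le ⟨_, 0, by simp, rfl⟩ (by rintro _ ⟨y, hy, rfl⟩; exact ht y hy)

theorem timeTranslate_timeTranslate (f : ℝ → Euc N → Euc N) (a b : ℝ) :
    timeTranslate (timeTranslate f a) b = timeTranslate f (a + b) := by
  funext s x
  simp only [timeTranslate]
  congr 1
  ring

theorem mOpt_timeTranslate (f : ℝ → Euc N → Euc N) (j : ℕ) (r t : ℝ) :
    mOpt (timeTranslate f r) j t = mOpt f j (t + r) := rfl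

theorem ae_comp_add_right {p : ℝ → Prop} (h : ∀ᵐ t : ℝ, p t) (r : ℝ) : ∀ᵐ t : ℝ, p (t + r) :=
  (measurePreserving_add_right volume r).quasiMeasurePreserving.ae h

theorem IsLC.timeTranslate (hf : IsLC f) (r : ℝ) : IsLC (timeTranslate f r) := by
  refine ⟨⟨?_, fun K hK => ?_⟩, fun K hK => ?_⟩
  · exact hf.1.1.comp_measurable
      (((measurable_fst.add_const r).prodMk measurable_snd) : Measurable
        fun p : ℝ × Euc N => (p.1 + r, p.2))
  · obtain ⟨m, hm0, hm, h⟩ := hf.1.2 K hK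
    exact ⟨fun t => m (t + r), fun t => hm0 _, hm.comp_add_right r, ae_comp_add_right h r⟩
  · obtain ⟨l, hl, h⟩ := hf.2 K hK
    exact ⟨fun t => l (t + r), hl.comp_add_right r, ae_comp_add_right h r⟩

theorem IsCara.intervalIntegrable_comp (hf : IsCara f) {a b : ℝ} {z : ℝ → Euc N}
    (hz : ContinuousOn z (uIcc a b)) : IntervalIntegrable (fun t => f t (z t)) volume a b := by
  obtain ⟨m, -, hm, h⟩ := hf.2 _ (isCompact_uIcc.image_of_continuousOn hz)
  rw [intervalIntegrable_iff]
  refine (intervalIntegrable_iff.1 (hm.intervalIntegrable a b)).mono' ?_ ?_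
  · have hpair : AEMeasurable (fun t => (t, z t)) (volume.restrict (uIoc a b)) :=
      aemeasurable_id.prodMk ((hz.mono uIoc_subset_uIcc).aemeasurable measurableSet_uIoc)
    exact (hf.1.measurable.comp_aemeasurable hpair).aestronglyMeasurable
  · refine (ae_restrict_iff' measurableSet_uIoc).2 (h.mono fun t ht htm => ?_)
    exact ht _ (mem_image_of_mem z (uIoc_subset_uIcc htm))

theorem IsLC.norm_integral_le_mOpt (hf : IsLC f) {j : ℕ} {a b : ℝ} (hab : a ≤ b)
    {z : ℝ → Euc N} (hz : ∀ t ∈ Icc a b, ‖z t‖ ≤ j) :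
    ‖∫ t in a..b, f t (z t)‖ ≤ ∫ t in a..b, mOpt f j t := by
  refine intervalIntegral.norm_integral_le_of_norm_le hab ?_
    ((hf.locInt_mOpt j).intervalIntegrable _ _)
  exact (hf.1.norm_le_mOpt j).mono fun t ht htm => ht _ (hz t (Ioc_subset_Icc_self htm))

end

/-! ### Moduli of continuity and convergence of the translates -/

section

variable {N : ℕ} {f g : ℝ → Euc N → Euc N}

theorem exists_integral_mOpt_lt
    (hequi : ∀ j : ℕ, ∀ r > (0:ℝ), ∀ ε > (0:ℝ), ∃ δ > (0:ℝ), ∀ τ' s s' : ℝ,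
      -r ≤ s → s ≤ s' → s' ≤ r → s' - s < δ → ∫ u in Icc s s', mOpt f j (u + τ') < ε)
    (j : ℕ) {ε : ℝ} (hε : 0 < ε) :
    ∃ δ > 0, ∀ a b : ℝ, a ≤ b → b - a < δ → ∫ t in a..b, mOpt f j t < ε := by
  obtain ⟨δ, hδ, h⟩ := hequi j 1 one_pos ε hε
  refine ⟨min δ 1, lt_min hδ one_pos, fun a b hab hlt => ?_⟩
  have := h a 0 (b - a) (by norm_num) (sub_nonneg.2 hab) (hlt.le.trans (min_le_right _ _))
    (by rw [sub_zero]; exact hlt.trans_le (min_le_left _ _))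
  rwa [integral_Icc_eq_integral_Ioc, ← intervalIntegral.integral_of_le (sub_nonneg.2 hab),
    intervalIntegral.integral_comp_add_right, zero_add, sub_add_cancel] at this

theorem bddAbove_integral_mOpt (hf : IsLC f)
    (hequi : ∀ j : ℕ, ∀ r > (0:ℝ), ∀ ε > (0:ℝ), ∃ δ > (0:ℝ), ∀ τ' s s' : ℝ,
      -r ≤ s → s ≤ s' → s' ≤ r → s' - s < δ → ∫ u in Icc s s', mOpt f j (u + τ') < ε)
    (j : ℕ) (s : ℝ) :
    ∃ M : ℝ, ∀ t : ℝ, ∫ u in t..(t + s), mOpt f j u ≤ M := by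
  obtain ⟨δ, hδ, h⟩ := exists_integral_mOpt_lt hequi j one_pos
  have hint := (hf.locInt_mOpt j).intervalIntegrable
  have key : ∀ k : ℕ, ∀ t, ∫ u in t..(t + k * (δ / 2)), mOpt f j u ≤ k := by
    intro k
    induction k with
    | zero => intro t; simp
    | succ k ih =>
      intro t
      rw [← intervalIntegral.integral_add_adjacent_intervals (hint t (t + k * (δ / 2)))
        (hint _ _)]
      have h1 := h (t + k * (δ / 2)) (t + (k + 1 : ℕ) * (δ / 2))
        (by push_cast; linarith) (by push_cast; linarith)
      have h2 := ih t
      push_cast at h1 ⊢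
      linarith
  obtain ⟨k, hk⟩ := exists_nat_ge (s / (δ / 2))
  rw [div_le_iff₀ (by positivity)] at hk
  refine ⟨k, fun t => ?_⟩
  rcases le_total 0 s with hs | hs
  · exact (intervalIntegral.integral_mono_interval le_rfl (by linarith) (by linarith)
      (Eventually.of_forall (mOpt_nonneg f j)) (hint _ _)).trans (key k t)
  · rw [intervalIntegral.integral_symm]
    have := intervalIntegral.integral_nonneg (μ := volume) (a := t + s) (b := t) (by linarith)
      fun u _ => mOpt_nonneg f j u
    exact (neg_nonpos.2 this).trans (Nat.cast_nonneg k)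

theorem integral_mOpt_le_modulus (hf : IsLC f)
    (hequi : ∀ j : ℕ, ∀ r > (0:ℝ), ∀ ε > (0:ℝ), ∃ δ > (0:ℝ), ∀ τ' s s' : ℝ,
      -r ≤ s → s ≤ s' → s' ≤ r → s' - s < δ → ∫ u in Icc s s', mOpt f j (u + τ') < ε)
    {Θ : SuitableModuli}
    (hΘ : ∀ (j : ℕ) (q₁ q₂ : ℚ) (s : ℝ), 0 ≤ s →
      Θ.θ j q₁ q₂ s = sSup {v : ℝ | ∃ t : ℝ, v = ∫ u in Icc t (t + s), mOpt f j u})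
    (j : ℕ) (q₁ q₂ : ℚ) {a b : ℝ} (hab : a ≤ b) :
    ∫ t in a..b, mOpt f j t ≤ Θ.θ j q₁ q₂ (b - a) := by
  obtain ⟨M, hM⟩ := bddAbove_integral_mOpt hf hequi j (b - a)
  have hconv : ∀ t, ∫ u in Icc t (t + (b - a)), mOpt f j u =
      ∫ u in t..(t + (b - a)), mOpt f j u := fun t => by
    rw [integral_Icc_eq_integral_Ioc, intervalIntegral.integral_of_le (by linarith)]
  rw [hΘ j q₁ q₂ _ (sub_nonneg.2 hab)]
  refine le_csSup ⟨M, ?_⟩ ⟨a, by rw [hconv, add_sub_cancel]⟩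
  rintro _ ⟨t, rfl⟩
  rw [hconv]
  exact hM t

/-- A bounded solution of a translate of `f`, stopped at both ends of its interval, obeys the
moduli of continuity given by the integrals of the optimal m-bounds of `f`. -/
theorem inK_stopped_solution (hf : IsLC f) {Θ : SuitableModuli} {j : ℕ}
    (hΘ : ∀ (q₁ q₂ : ℚ) (a b : ℝ), a ≤ b → ∫ t in a..b, mOpt f j t ≤ Θ.θ j q₁ q₂ (b - a))
    {p r S : ℝ} (hrS : r ≤ S) {x₀ : Euc N} {z : ℝ → Euc N} (hz : ContinuousOn z (Icc r S))
    (hsol : ∀ t ∈ Icc r S, z t = x₀ + ∫ s in r..t, timeTranslate f p s (z s))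
    (hbdd : ∀ t ∈ Icc r S, ‖z t‖ ≤ j) (q₁ q₂ : ℚ) :
    inK Θ j q₁ q₂ fun t => z (projIcc r S hrS t) := by
  have hincr : ∀ a ∈ Icc r S, ∀ b ∈ Icc r S, a ≤ b → ‖z b - z a‖ ≤ Θ.θ j q₁ q₂ (b - a) := by
    intro a ha b hb hab
    have hint : ∀ c ∈ Icc r S, IntervalIntegrable
        (fun s => timeTranslate f p s (z s)) volume r c := fun c hc =>
      (hf.timeTranslate p).1.intervalIntegrable_comp
        (hz.mono (by rw [uIcc_of_le hc.1]; exact Icc_subset_Icc_right hc.2))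
    rw [hsol a ha, hsol b hb, add_sub_add_left_eq_sub,
      intervalIntegral.integral_interval_sub_left (hint b hb) (hint a ha)]
    calc _ ≤ ∫ t in a..b, mOpt (timeTranslate f p) j t :=
          (hf.timeTranslate p).norm_integral_le_mOpt hab
            fun t ht => hbdd t ⟨ha.1.trans ht.1, ht.2.trans hb.2⟩
      _ = ∫ t in (a + p)..(b + p), mOpt f j t := by
          simp only [mOpt_timeTranslate]
          exact intervalIntegral.integral_comp_add_right _ _
      _ ≤ Θ.θ j q₁ q₂ (b - a) := by
          simpa using hΘ q₁ q₂ (a + p) (b + p) (by linarith)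
  have habs : ∀ a ∈ Icc r S, ∀ b ∈ Icc r S, ‖z a - z b‖ ≤ Θ.θ j q₁ q₂ |a - b| := by
    intro a ha b hb
    rcases le_total a b with hab | hab
    · rw [norm_sub_rev, abs_sub_comm, abs_of_nonneg (sub_nonneg.2 hab)]
      exact hincr a ha b hb hab
    · rw [abs_of_nonneg (sub_nonneg.2 hab)]
      exact hincr b hb a ha hab
  refine ⟨?_, fun t _ => hbdd _ (projIcc r S hrS t).2, fun t _ s _ => ?_⟩
  · exact (hz.comp_continuous (continuous_subtype_val.comp continuous_projIcc)
      fun t => (projIcc r S hrS t).2).continuousOn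
  · exact (habs _ (projIcc r S hrS t).2 _ (projIcc r S hrS s).2).trans
      (Θ.mono j q₁ q₂ (mem_Ici.2 (abs_nonneg _)) (mem_Ici.2 (abs_nonneg _))
        (abs_projIcc_sub_projIcc hrS))

/-- Convergence in the `σ_Θ` sense of translates is uniform with respect to the endpoint of the
interval of integration, which need not be rational. -/
theorem SigmaTendsto.eventually_norm_integral_le (hf : IsLC f) (hg : IsLC g)
    {Θ : SuitableModuli} {ts : ℕ → ℝ}
    (hconv : SigmaTendsto Θ (fun n => timeTranslate f (ts n)) g) {j : ℕ}
    (hequi : ∀ ε > (0:ℝ), ∃ δ > (0:ℝ), ∀ a b : ℝ, a ≤ b → b - a < δ →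
      ∫ t in a..b, mOpt f j t < ε)
    (A B : ℝ) {ε : ℝ} (hε : 0 < ε) :
    ∀ᶠ n in atTop, ∀ z : ℝ → Euc N, Continuous z → (∀ t, ‖z t‖ ≤ j) →
      (∀ q₁ q₂, inK Θ j q₁ q₂ z) → ∀ t ∈ Icc A B,
        ‖∫ s in A..t, (timeTranslate f (ts n) s (z s) - g s (z s))‖ ≤ ε := by
  have hε5 : 0 < ε / 5 := by positivity
  obtain ⟨δ₁, hδ₁, h₁⟩ := hequi _ hε5
  obtain ⟨δ₂, hδ₂, h₂⟩ := (hg.locInt_mOpt j).exists_integral_lt (A - 1) B hε5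
  obtain ⟨q, hq0, hq⟩ := exists_rat_btwn (lt_min (lt_min hδ₁ hδ₂) one_pos)
  have hqδ₁ : (q : ℝ) < δ₁ := hq.trans_le ((min_le_left _ _).trans (min_le_left _ _))
  have hqδ₂ : (q : ℝ) < δ₂ := hq.trans_le ((min_le_left _ _).trans (min_le_right _ _))
  have hq1 : (q : ℝ) < 1 := hq.trans_le (min_le_right _ _)
  set k₀ := ⌊A / q⌋
  have hgrid := (Filter.eventually_all_finset (Finset.Icc k₀ ⌊B / q⌋)).2 fun k _ =>
    hconv j (k₀ * q) (k * q) (ε / 5) hε5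
  filter_upwards [hgrid] with n hn z hz hzj hzK t ht
  have hft := hf.timeTranslate (ts n)
  have hfi : ∀ a b, IntervalIntegrable (fun s => timeTranslate f (ts n) s (z s)) volume a b :=
    fun a b => hft.1.intervalIntegrable_comp hz.continuousOn
  have hgi : ∀ a b, IntervalIntegrable (fun s => g s (z s)) volume a b :=
    fun a b => hg.1.intervalIntegrable_comp hz.continuousOn
  have hint : ∀ a b, IntervalIntegrable
      (fun s => timeTranslate f (ts n) s (z s) - g s (z s)) volume a b :=
    fun a b => (hfi a b).sub (hgi a b)
  have hfloor : ∀ c : ℝ, (⌊c / q⌋ : ℝ) * q ≤ c ∧ c - ⌊c / q⌋ * q < q := by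
    intro c
    have h1 := mul_le_mul_of_nonneg_right (Int.floor_le (c / q)) hq0.le
    have h2 := mul_lt_mul_of_pos_right (Int.lt_floor_add_one (c / q)) hq0
    rw [div_mul_cancel₀ _ hq0.ne'] at h1 h2
    exact ⟨h1, by linarith⟩
  have hsmall : ∀ c, A ≤ c → c ≤ B → ‖∫ s in (⌊c / q⌋ * q : ℝ)..c,
      (timeTranslate f (ts n) s (z s) - g s (z s))‖ ≤ 2 * (ε / 5) := by
    intro c hAc hcB
    obtain ⟨hc1, hc2⟩ := hfloor c
    rw [intervalIntegral.integral_sub (hfi _ _) (hgi _ _)]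
    refine (norm_sub_le _ _).trans ?_
    have e1 := hft.norm_integral_le_mOpt hc1 fun t _ => hzj t
    have e2 := hg.norm_integral_le_mOpt hc1 fun t _ => hzj t
    simp only [mOpt_timeTranslate] at e1
    rw [intervalIntegral.integral_comp_add_right] at e1
    have e3 := h₁ (⌊c / q⌋ * q + ts n) (c + ts n) (by linarith) (by linarith)
    have e4 := h₂ (⌊c / q⌋ * q) c (by linarith) hc1 hcB (by linarith)
    linarith
  set k := ⌊t / q⌋
  have hk₀k : k₀ ≤ k := Int.floor_le_floor (div_le_div_of_nonneg_right ht.1 hq0.le)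
  have hkB : k ≤ ⌊B / q⌋ := Int.floor_le_floor (div_le_div_of_nonneg_right ht.2 hq0.le)
  have hmid := hn k (Finset.mem_Icc.2 ⟨hk₀k, hkB⟩) z (hzK _ _)
  have hle : (k₀ : ℝ) * q ≤ k * q :=
    mul_le_mul_of_nonneg_right (by exact_mod_cast hk₀k) hq0.le
  push_cast at hmid
  rw [integral_Icc_eq_integral_Ioc, ← intervalIntegral.integral_of_le hle] at hmid
  have hA := hsmall A le_rfl (ht.1.trans ht.2)
  have hB := hsmall t ht.1 ht.2
  have hsplit : ∫ s in A..t, (timeTranslate f (ts n) s (z s) - g s (z s)) =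
      (∫ s in (k₀ * q : ℝ)..(k * q), (timeTranslate f (ts n) s (z s) - g s (z s))) -
      (∫ s in (k₀ * q : ℝ)..A, (timeTranslate f (ts n) s (z s) - g s (z s))) +
      ∫ s in (k * q : ℝ)..t, (timeTranslate f (ts n) s (z s) - g s (z s)) := by
    rw [← intervalIntegral.integral_add_adjacent_intervals (hint A (k * q)) (hint _ t),
      ← intervalIntegral.integral_interval_sub_left (hint (k₀ * q) (k * q)) (hint _ A)]
  rw [hsplit]
  refine (norm_add_le _ _).trans ?_
  have := norm_sub_le
    (∫ s in (k₀ * q : ℝ)..(k * q), (timeTranslate f (ts n) s (z s) - g s (z s)))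
    (∫ s in (k₀ * q : ℝ)..A, (timeTranslate f (ts n) s (z s) - g s (z s)))
  linarith

/-! ### Continuous dependence -/

theorem IsSolOn.comp_sub_right {r : ℝ} {x₀ : Euc N} {x : ℝ → Euc N}
    (hx : IsSolOn (timeTranslate g r) x₀ x) :
    ContinuousOn (fun t => x (t - r)) (Ici r) ∧
      ∀ t ∈ Ici r, x (t - r) = x₀ + ∫ s in r..t, g s (x (s - r)) := by
  refine ⟨hx.1.comp (continuous_id.sub continuous_const).continuousOn
    fun t ht => mem_Ici.2 (sub_nonneg.2 (mem_Ici.1 ht)), fun t ht => ?_⟩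
  rw [hx.2 (t - r) (sub_nonneg.2 (mem_Ici.1 ht))]
  have := intervalIntegral.integral_comp_sub_right (a := r) (b := t)
    (fun s => timeTranslate g r s (x s)) r
  simp only [timeTranslate, sub_add_cancel, sub_self] at this ⊢
  rw [this]

/-- The distance between a solution of `ẋ = g(t,x)` and a solution of `ẏ = h(t,y)` staying in a
ball is controlled by the integral of `h - g` along the latter. -/
theorem norm_sub_le_of_norm_integral_le (hg : IsLC g) {h : ℝ → Euc N → Euc N} (hh : IsCara h)
    {j : ℕ} {l : ℝ → ℝ} (hl : LocInt l)
    (hlip : ∀ᵐ t : ℝ, ∀ x y : Euc N, ‖x‖ ≤ j → ‖y‖ ≤ j → ‖g t x - g t y‖ ≤ l t * ‖x - y‖)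
    {r t ε : ℝ} (hrt : r ≤ t) {x₀ : Euc N} {x y : ℝ → Euc N}
    (hxc : ContinuousOn x (Icc r t)) (hyc : ContinuousOn y (Icc r t))
    (hxj : ∀ s ∈ Icc r t, ‖x s‖ ≤ j) (hyj : ∀ s ∈ Icc r t, ‖y s‖ ≤ j)
    (hx : x t = x₀ + ∫ s in r..t, g s (x s)) (hy : y t = x₀ + ∫ s in r..t, h s (y s))
    (hε : ‖∫ s in r..t, (h s (y s) - g s (y s))‖ ≤ ε) :
    ‖y t - x t‖ ≤ ε + ∫ s in r..t, l s * ‖y s - x s‖ := by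
  rw [← uIcc_of_le hrt] at hxc hyc
  have hgx := hg.1.intervalIntegrable_comp hxc
  have hgy := hg.1.intervalIntegrable_comp hyc
  have hhy := hh.intervalIntegrable_comp hyc
  have heq : y t - x t = (∫ s in r..t, (h s (y s) - g s (y s))) +
      ∫ s in r..t, (g s (y s) - g s (x s)) := by
    rw [intervalIntegral.integral_sub hhy hgy, intervalIntegral.integral_sub hgy hgx, hx, hy]
    abel
  rw [heq]
  refine (norm_add_le _ _).trans (add_le_add hε ?_)
  refine intervalIntegral.norm_integral_le_of_norm_le hrt ?_
    ((hl.intervalIntegrable _ _).mul_continuousOn (hyc.sub hxc).norm)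
  exact hlip.mono fun s hs hsm =>
    hs _ _ (hyj s (Ioc_subset_Icc_self hsm)) (hxj s (Ioc_subset_Icc_self hsm))

/-- A function staying strictly inside a ball as long as it stays in the closed ball never leaves
it. -/
theorem norm_lt_of_forall_norm_le_imp_norm_lt {y : ℝ → Euc N} {r B R : ℝ}
    (hy : ContinuousOn y (Icc r B))
    (h : ∀ S ∈ Icc r B, (∀ t ∈ Icc r S, ‖y t‖ ≤ R) → ‖y S‖ < R) (h0 : ‖y r‖ < R) :
    ∀ t ∈ Icc r B, ‖y t‖ < R := by
  by_contra! hcon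
  obtain ⟨t, ht, hRt⟩ := hcon
  have hcomp : IsCompact (Icc r B ∩ (fun t => ‖y t‖) ⁻¹' Ici R) :=
    isCompact_Icc.of_isClosed_subset (hy.norm.preimage_isClosed_of_isClosed isClosed_Icc
      isClosed_Ici) inter_subset_left
  obtain ⟨S, ⟨hS, hRS⟩, hleast⟩ := hcomp.exists_isLeast ⟨t, ht, hRt⟩
  have hlt : ∀ s ∈ Ico r S, ‖y s‖ ≤ R := fun s hs => by
    by_contra! hsR
    exact (hleast ⟨⟨hs.1, hs.2.le.trans hS.2⟩, hsR.le⟩).not_gt hs.2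
  have hrS : r ≠ S := by
    rintro rfl
    exact (mem_Ici.1 hRS).not_gt h0
  have hcl : ∀ s ∈ Icc r S, ‖y s‖ ≤ R := by
    rw [← closure_Ico hrS]
    intro s hs
    refine ContinuousWithinAt.closure_le hs ?_ continuousWithinAt_const hlt
    rw [closure_Ico hrS] at hs
    exact (hy.norm s ⟨hs.1, hs.2.trans hS.2⟩).mono
      (Ico_subset_Icc_self.trans (Icc_subset_Icc_right hS.2))
  exact (mem_Ici.1 hRS).not_gt (h S hS hcl)

/-- Solutions of the translates of `f` converge to the solution of the limit equation, for fixed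
initial data. -/
theorem SigmaTendsto.eventually_norm_sub_le (hf : IsLC f) (hg : IsLC g)
    {Θ : SuitableModuli} {ts : ℕ → ℝ}
    (hconv : SigmaTendsto Θ (fun n => timeTranslate f (ts n)) g)
    (hequi : ∀ (j : ℕ), ∀ ε > (0:ℝ), ∃ δ > (0:ℝ), ∀ a b : ℝ, a ≤ b → b - a < δ →
      ∫ t in a..b, mOpt f j t < ε)
    (hΘ : ∀ (j : ℕ) (q₁ q₂ : ℚ) (a b : ℝ), a ≤ b →
      ∫ t in a..b, mOpt f j t ≤ Θ.θ j q₁ q₂ (b - a))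
    {r B : ℝ} (hrB : r ≤ B) {x₀ : Euc N} {x : ℝ → Euc N} (hxc : ContinuousOn x (Icc r B))
    (hx : ∀ t ∈ Icc r B, x t = x₀ + ∫ s in r..t, g s (x s)) {η : ℝ} (hη : 0 < η) :
    ∀ᶠ n in atTop, ∀ y : ℝ → Euc N, ContinuousOn y (Icc r B) →
      (∀ t ∈ Icc r B, y t = x₀ + ∫ s in r..t, timeTranslate f (ts n) s (y s)) →
      ∀ t ∈ Icc r B, ‖y t - x t‖ ≤ η := by
  obtain ⟨R, hR⟩ := (isCompact_Icc (a := r) (b := B)).exists_bound_of_continuousOn hxc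
  obtain ⟨i, hi⟩ := exists_nat_ge R
  set j := i + 1
  have hxi : ∀ t ∈ Icc r B, ‖x t‖ + 1 ≤ j := fun t ht => by
    have := hR t ht
    simp only [j]; push_cast; linarith
  obtain ⟨l, hl0, hl, hlip⟩ := hg.exists_lipschitz j
  obtain ⟨C, hC, hgron⟩ := exists_gronwall_const hl hl0 r B
  set ε := min η (1 / 2) / (C + 1)
  have hε : 0 < ε := by positivity
  have hCε : C * ε ≤ min η (1 / 2) := by
    have : (C + 1) * ε = min η (1 / 2) := mul_div_cancel₀ _ (by positivity)
    linarith
  filter_upwards [hconv.eventually_norm_integral_le hf hg (hequi j) r B hε] with n hn y hyc hy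
  have hclose : ∀ S ∈ Icc r B, (∀ t ∈ Icc r S, ‖y t‖ ≤ j) →
      ∀ t ∈ Icc r S, ‖y t - x t‖ ≤ min η (1 / 2) := by
    intro S hS hyj
    have hsub : Icc r S ⊆ Icc r B := Icc_subset_Icc_right hS.2
    set z : ℝ → Euc N := fun t => y (projIcc r S hS.1 t)
    have hzK := inK_stopped_solution hf (hΘ j) hS.1 (hyc.mono hsub)
      (fun t ht => hy t (hsub ht)) hyj
    have hzc : Continuous z := (hyc.mono hsub).comp_continuous
      (continuous_subtype_val.comp continuous_projIcc) fun t => (projIcc r S hS.1 t).2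
    have hzy : ∀ t ∈ Icc r S, z t = y t := fun t ht => by
      simp only [z, projIcc_of_mem hS.1 ht]
    refine fun t ht => (hgron ε hε.le S hS.2 (fun t => ‖y t - x t‖)
      ((hyc.sub hxc).norm.mono hsub) (fun _ => norm_nonneg _) (fun t ht => ?_) t ht).trans hCε
    have htB : Icc r t ⊆ Icc r B := Icc_subset_Icc_right (ht.2.trans hS.2)
    refine norm_sub_le_of_norm_integral_le hg (hf.timeTranslate (ts n)).1 hl hlip ht.1
      (hxc.mono htB) (hyc.mono htB) (fun s hs => by linarith [hxi s (htB hs)])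
      (fun s hs => hyj s ⟨hs.1, hs.2.trans ht.2⟩) (hx t (hsub ht)) (hy t (hsub ht)) ?_
    have := hn z hzc (fun t => hyj _ (projIcc r S hS.1 t).2) hzK t (hsub ht)
    refine le_of_eq_of_le (congrArg norm (intervalIntegral.integral_congr fun s hs => ?_)) this
    rw [uIcc_of_le ht.1] at hs
    simp only [hzy s ⟨hs.1, hs.2.trans ht.2⟩]
  have hstay := norm_lt_of_forall_norm_le_imp_norm_lt (R := j) hyc (fun S hS hyj => by
      have h1 := hclose S hS hyj S (right_mem_Icc.2 hS.1)
      have h2 := hxi S hS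
      have h3 := norm_le_norm_add_norm_sub' (y S) (x S)
      linarith [min_le_right η (1 / 2)]) (by
      have hr := left_mem_Icc.2 hrB
      have : y r = x r := by rw [hx r hr, hy r hr]; simp
      rw [this]
      linarith [hxi r hr])
  exact fun t ht => (hclose B (right_mem_Icc.2 hrB) (fun t ht => (hstay t ht).le) t ht).trans
    (min_le_left _ _)

end

/-- uniform ultimate boundedness on `[τ,∞)` of the solutions of
`ẋ = f(t,x)` implies uniform ultimate boundedness for every `g` in the omega
limit set of `f` (σ_Θ-limit of translates `f_{t_n}`, `t_n → +∞`). -/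
theorem stmt12 {N : ℕ} (f : ℝ → Euc N → Euc N) (hf : IsLC f)
    (hequi : ∀ j : ℕ, ∀ r > (0:ℝ), ∀ ε > (0:ℝ), ∃ δ > (0:ℝ), ∀ τ' s s' : ℝ,
      -r ≤ s → s ≤ s' → s' ≤ r → s' - s < δ → ∫ u in Icc s s', mOpt f j (u + τ') < ε)
    (Θ : SuitableModuli)
    (hΘ : ∀ (j : ℕ) (q₁ q₂ : ℚ) (s : ℝ), 0 ≤ s →
      Θ.θ j q₁ q₂ s = sSup {v : ℝ | ∃ t : ℝ, v = ∫ u in Icc t (t + s), mOpt f j u})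
    (g : ℝ → Euc N → Euc N) (hg : IsLC g)
    (ts : ℕ → ℝ) (hts : Tendsto ts atTop atTop)
    (hconv : SigmaTendsto Θ (fun n => timeTranslate f (ts n)) g)
    (hfsol : ∀ s ≥ (0:ℝ), ∀ x₀ : Euc N, ∃ x : ℝ → Euc N, IsSolOn (timeTranslate f s) x₀ x)
    (hgsol : ∀ (r : ℝ) (x₀ : Euc N), ∃ x : ℝ → Euc N, IsSolOn (timeTranslate g r) x₀ x)
    (τ c : ℝ) (hc : 0 < c)
    (hdiss : ∀ d > (0:ℝ), ∃ T > (0:ℝ), ∀ r ≥ τ, ∀ t ≥ T, ∀ x₀ : Euc N, ‖x₀‖ ≤ d →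
      ∀ x : ℝ → Euc N, IsSolOn (timeTranslate f r) x₀ x → ‖x t‖ ≤ c) :
    ∀ d > (0:ℝ), ∃ T' > (0:ℝ), ∀ (r : ℝ), ∀ t ≥ T', ∀ x₀ : Euc N, ‖x₀‖ ≤ d →
      ∀ x : ℝ → Euc N, IsSolOn (timeTranslate g r) x₀ x → ‖x t‖ ≤ c := by
  have hequi' := fun j ε (hε : (0:ℝ) < ε) => exists_integral_mOpt_lt hequi j hε
  have hΘ' := fun j q₁ q₂ a b (hab : a ≤ b) => integral_mOpt_le_modulus hf hequi hΘ j q₁ q₂ hab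
  intro d hd
  obtain ⟨T, hT, hdiss⟩ := hdiss d hd
  refine ⟨T, hT, fun r t ht x₀ hx₀ x hx => le_of_forall_pos_le_add fun η hη => ?_⟩
  have hrB : r ≤ r + t := by linarith
  obtain ⟨hxc, hxs⟩ := hx.comp_sub_right
  have hclose := hconv.eventually_norm_sub_le hf hg hequi' hΘ' hrB (hxc.mono Icc_subset_Ici_self)
    (fun s hs => hxs s hs.1) hη
  obtain ⟨n, hn, hτn, h0n⟩ := (hclose.and ((hts.eventually_ge_atTop (τ - r)).and
    (hts.eventually_ge_atTop (-r)))).exists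
  obtain ⟨y, hy⟩ := hfsol (ts n + r) (by linarith) x₀
  have hyc := hdiss (ts n + r) (by linarith) t ht x₀ hx₀ y hy
  rw [← timeTranslate_timeTranslate] at hy
  obtain ⟨hyc', hys⟩ := hy.comp_sub_right
  have := hn _ (hyc'.mono Icc_subset_Ici_self) (fun s hs => hys s hs.1) (r + t)
    (right_mem_Icc.2 hrB)
  rw [add_sub_cancel_left] at this
  linarith [norm_le_norm_add_norm_sub (y t) (x t)]
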